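/- arXiv:2412.08474 — 5 statements merged into one kernel-verified Lean document; each statement's English description precedes it below -/
import Mathlib

section
/- Let (R, ·, (P_ω)_{ω∈S}) be a Rota-Baxter family algebra of weight λ, and let θ : R → R be a linear map satisfying θ(x·y) = θ(x)·θ(y) and P_ω(θ(x)) = θ(P_ω(x)) for all x, y ∈ R and ω ∈ S. Define x ·_θ y := θ(x·y). Then (R, ·_θ, (P_ω)_{ω∈S}, θ) is a Rota-Baxter family Hom-associative algebra of weight λ. -/
/-- The axioms of a Rota-Baxter family Hom-associative algebra of weight `lam`,
stated for arbitrary operations. -/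
def IsRBFOps {k S M : Type*} [Field k] [Semigroup S] [AddCommGroup M] [Module k M]
    (lam : k) (mul : M → M → M) (P : S → M → M) (theta : M → M) : Prop :=
  (∀ x y z : M, mul (theta x) (mul y z) = mul (mul x y) (theta z)) ∧
  (∀ (α β : S) (x y : M), mul (P α x) (P β y)
      = P (α * β) (mul (P α x) y + mul x (P β y) + lam • mul x y)) ∧
  (∀ (ω : S) (x : M), P ω (theta x) = theta (P ω x))

/-- Let `(R, ·, (P_ω)_{ω∈S})` be a Rota-Baxter family algebra of weight `λ`
(i.e. `·` is a bilinear associative multiplication and the `P_ω` satisfy the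
Rota-Baxter family relation), and let `θ : R → R` be a linear map with
`θ(x·y) = θ(x)·θ(y)` and `P_ω(θ(x)) = θ(P_ω(x))`. Then
`(R, ·_θ := θ ∘ ·, (P_ω)_{ω∈S}, θ)` is a Rota-Baxter family Hom-associative
algebra of weight `λ`. -/
theorem stmt0 {k S R : Type*} [Field k] [Semigroup S] [AddCommGroup R] [Module k R]
    (lam : k) (mul : R →ₗ[k] R →ₗ[k] R)
    (hassoc : ∀ x y z : R, mul (mul x y) z = mul x (mul y z))
    (P : S → R →ₗ[k] R)
    (hRB : ∀ (α β : S) (x y : R),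
      mul (P α x) (P β y) = P (α * β) (mul (P α x) y + mul x (P β y) + lam • mul x y))
    (θ : R →ₗ[k] R)
    (hθmul : ∀ x y : R, θ (mul x y) = mul (θ x) (θ y))
    (hθP : ∀ (ω : S) (x : R), P ω (θ x) = θ (P ω x)) :
    IsRBFOps lam (fun x y => θ (mul x y)) (fun ω x => P ω x) (fun x => θ x) := by
  refine ⟨fun x y z => ?_, fun α β x y => ?_, hθP⟩
  · simp only [← hθmul, hassoc]
  · simp only [hRB, ← hθP, map_add, map_smul]
end

section
/- Let R be a Rota-Baxter family Hom-associative algebra of weight λ and let E = (E, ·_E, (P_{ω,E})_{ω∈S}, θ_E) be an extension of R. Let ρ : E → R be a linear retraction (ρ(a) = a for all a ∈ R) and set V := ker ρ. Define, for a ∈ R, x, y ∈ V, ω ∈ S: a▷x := a ·_E x − ρ(a ·_E x); x◁a := x ·_E a − ρ(x ·_E a); a↼x := ρ(a ·_E x); x⇀a := ρ(x ·_E a); f(x,y) := ρ(x ·_E y); x ·_V y := x ·_E y − ρ(x ·_E y); Q_ω(x) := ρ(P_{ω,E}(x)); P_{ω,V}(x) := P_{ω,E}(x) − ρ(P_{ω,E}(x));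 η(x) := ρ(θ_E(x)); θ_V(x) := θ_E(x) − ρ(θ_E(x)). Then this extending datum Ω(R,V) is a Rota-Baxter family Hom extending structure of R through V, and the map φ : R♮V → E, φ(a,x) := a + x, is an isomorphism of Rota-Baxter family Hom-associative algebras satisfying φ(a,0) = a for all a ∈ R (φ stabilizes R) and, writing π : E → V for the projection along R, π(φ(a,x)) = x for all (a,x) (φ co-stabilizes V); hence R♮V ≈ E. -/
/-- The data of a Rota-Baxter family Hom-associative algebra: a bilinear
multiplication, a family of linear operators indexed by a semigroup `S`,
and a linear twisting map. -/
structure RBFData (k S R : Type*) [Field k] [Semigroup S]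
    [AddCommGroup R] [Module k R] where
  mul : R →ₗ[k] R →ₗ[k] R
  P : S → R →ₗ[k] R
  theta : R →ₗ[k] R

/-- `(R, ·, (P_ω), θ)` is a Rota-Baxter family Hom-associative algebra of weight `lam`. -/
def RBFData.IsRBF {k S R : Type*} [Field k] [Semigroup S] [AddCommGroup R] [Module k R]
    (A : RBFData k S R) (lam : k) : Prop :=
  IsRBFOps lam (fun x y => A.mul x y) (fun ω x => A.P ω x) (fun x => A.theta x)

/-- An extending datum `Ω(R,V)` of `R` through `V`:
`dR` is `▷ : R×V→V`, `dL` is `◁ : V×R→V`, `hR` is `⇀ : V×R→R`, `hL` is `↼ : R×V→R`,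
`f : V×V→R` is the cocycle, `mulV : V×V→V`, and the linear maps
`Q_ω : V→R`, `PV_ω : V→V`, `eta : V→R`, `thetaV : V→V`. -/
structure ExtDatum (k S R V : Type*) [Field k] [Semigroup S]
    [AddCommGroup R] [Module k R] [AddCommGroup V] [Module k V] where
  dR : R →ₗ[k] V →ₗ[k] V
  dL : V →ₗ[k] R →ₗ[k] V
  hR : V →ₗ[k] R →ₗ[k] R
  hL : R →ₗ[k] V →ₗ[k] R
  f : V →ₗ[k] V →ₗ[k] R
  mulV : V →ₗ[k] V →ₗ[k] V
  Q : S → V →ₗ[k] R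
  PV : S → V →ₗ[k] V
  eta : V →ₗ[k] R
  thetaV : V →ₗ[k] V

/-- The multiplication of the (prospective) unified product `R ♮ V`. -/
def natMul {k S R V : Type*} [Field k] [Semigroup S]
    [AddCommGroup R] [Module k R] [AddCommGroup V] [Module k V]
    (A : RBFData k S R) (D : ExtDatum k S R V) : R × V → R × V → R × V := fun p q =>
  (A.mul p.1 q.1 + D.hL p.1 q.2 + D.hR p.2 q.1 + D.f p.2 q.2,
   D.dR p.1 q.2 + D.dL p.2 q.1 + D.mulV p.2 q.2)

/-- The Rota-Baxter family of the (prospective) unified product `R ♮ V`. -/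
def natP {k S R V : Type*} [Field k] [Semigroup S]
    [AddCommGroup R] [Module k R] [AddCommGroup V] [Module k V]
    (A : RBFData k S R) (D : ExtDatum k S R V) : S → R × V → R × V := fun ω p =>
  (A.P ω p.1 + D.Q ω p.2, D.PV ω p.2)

/-- The twisting map of the (prospective) unified product `R ♮ V`. -/
def natTheta {k S R V : Type*} [Field k] [Semigroup S]
    [AddCommGroup R] [Module k R] [AddCommGroup V] [Module k V]
    (A : RBFData k S R) (D : ExtDatum k S R V) : R × V → R × V := fun p =>
  (A.theta p.1 + D.eta p.2, D.thetaV p.2)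

/-- An extending datum is a Rota-Baxter family Hom extending structure when the
unified product `R ♮ V` is a Rota-Baxter family Hom-associative algebra of weight `lam`. -/
def IsExtendingStructure {k S R V : Type*} [Field k] [Semigroup S]
    [AddCommGroup R] [Module k R] [AddCommGroup V] [Module k V]
    (lam : k) (A : RBFData k S R) (D : ExtDatum k S R V) : Prop :=
  IsRBFOps lam (natMul A D) (natP A D) (natTheta A D)

/-- The Rota-Baxter family Hom-associative axioms pull back along an injective linear map
compatible with the operations. -/
theorem IsRBFOps.of_injective {k S M N : Type*} [Field k] [Semigroup S]
    [AddCommGroup M] [Module k M] [AddCommGroup N] [Module k N] {lam : k}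
    {mul : M → M → M} {P : S → M → M} {theta : M → M}
    {mul' : N → N → N} {P' : S → N → N} {theta' : N → N}
    (h : IsRBFOps lam mul P theta) (φ : N →ₗ[k] M) (hφ : Function.Injective φ)
    (hmul : ∀ x y, φ (mul' x y) = mul (φ x) (φ y))
    (hP : ∀ ω x, φ (P' ω x) = P ω (φ x))
    (htheta : ∀ x, φ (theta' x) = theta (φ x)) :
    IsRBFOps lam mul' P' theta' := by
  obtain ⟨hassoc, hRB, hcomm⟩ := h
  refine ⟨fun x y z => hφ ?_, fun α β x y => hφ ?_, fun ω x => hφ ?_⟩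
  · simp only [hmul, htheta, hassoc]
  · simp only [hmul, hP, map_add, map_smul, hRB]
  · simp only [hP, htheta, hcomm]

section Retraction

variable {k S E : Type*} [Field k] [Semigroup S] [AddCommGroup E] [Module k E]
  {Rs : Submodule k E} {ρ : E →ₗ[k] E}

/-- The projection of `E` onto `ker ρ` along `Rs`, for a linear retraction `ρ` of `E` onto `Rs`. -/
def kerProj (ρ : E →ₗ[k] E) (hmem : ∀ u : E, ρ u ∈ Rs) (hid : ∀ a ∈ Rs, ρ a = a) :
    E →ₗ[k] ↥(LinearMap.ker ρ) :=
  (LinearMap.id - ρ).codRestrict _ fun u => by simp [hid _ (hmem u)]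

/-- The extending datum of `Rs` through `ker ρ` induced by a linear retraction `ρ` of `E`
onto `Rs`. -/
def retractionDatum (AE : RBFData k S E) (ρ : E →ₗ[k] E) (hmem : ∀ u : E, ρ u ∈ Rs)
    (hid : ∀ a ∈ Rs, ρ a = a) : ExtDatum k S ↥Rs ↥(LinearMap.ker ρ) :=
  let pR := ρ.codRestrict Rs hmem
  let pV := kerProj ρ hmem hid
  let iR := Rs.subtype
  let iV := (LinearMap.ker ρ).subtype
  { dR := (AE.mul.compl₁₂ iR iV).compr₂ pV
    dL := (AE.mul.compl₁₂ iV iR).compr₂ pV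
    hR := (AE.mul.compl₁₂ iV iR).compr₂ pR
    hL := (AE.mul.compl₁₂ iR iV).compr₂ pR
    f := (AE.mul.compl₁₂ iV iV).compr₂ pR
    mulV := (AE.mul.compl₁₂ iV iV).compr₂ pV
    Q := fun ω => pR ∘ₗ AE.P ω ∘ₗ iV
    PV := fun ω => pV ∘ₗ AE.P ω ∘ₗ iV
    eta := pR ∘ₗ AE.theta ∘ₗ iV
    thetaV := pV ∘ₗ AE.theta ∘ₗ iV }

/-- The sum map `(a, x) ↦ a + x` from `Rs × ker ρ` to `E` is bijective. -/
theorem bijective_add_ker (hmem : ∀ u : E, ρ u ∈ Rs) (hid : ∀ a ∈ Rs, ρ a = a) :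
    Function.Bijective
      (fun p : ↥Rs × ↥(LinearMap.ker ρ) => (↑p.1 + ↑p.2 : E)) := by
  have hρ : ∀ p : ↥Rs × ↥(LinearMap.ker ρ), ρ (↑p.1 + ↑p.2) = p.1 := fun p => by
    rw [map_add, hid _ p.1.2, LinearMap.mem_ker.1 p.2.2, add_zero]
  refine ⟨fun p q h => ?_, fun u => ⟨(⟨ρ u, hmem u⟩, kerProj ρ hmem hid u), ?_⟩⟩
  · dsimp only at h
    have h₁ : (p.1 : E) = q.1 := by rw [← hρ p, h, hρ q]
    rw [h₁] at h
    exact Prod.ext (Subtype.ext h₁) (Subtype.ext (add_left_cancel h))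
  · simp [kerProj]

end Retraction

/-- Let `R ⊆ E` be an extension of Rota-Baxter family Hom-associative algebras
(`Rs` is a subspace of `E` on which the operations of `E` restrict to the given
structure `AR`), and let `ρ : E → R` be a linear retraction with `V := ker ρ`.
Then the extending datum of Eq. (3.3) (defined via `ρ`) is a Rota-Baxter family
Hom extending structure of `R` through `V`, and `φ : R ♮ V → E, (a,x) ↦ a + x`
is an isomorphism of Rota-Baxter family Hom-associative algebras which
stabilizes `R` and co-stabilizes `V`; hence `R ♮ V ≈ E`. -/
theorem stmt6 {k S E : Type*} [Field k] [Semigroup S] [AddCommGroup E] [Module k E]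
    (lam : k) (AE : RBFData k S E) (hAE : AE.IsRBF lam)
    (Rs : Submodule k E) (AR : RBFData k S ↥Rs) (hAR : AR.IsRBF lam)
    (hRmul : ∀ a b : ↥Rs, AE.mul ↑a ↑b = ↑(AR.mul a b))
    (hRP : ∀ (ω : S) (a : ↥Rs), AE.P ω ↑a = ↑(AR.P ω a))
    (hRtheta : ∀ a : ↥Rs, AE.theta ↑a = ↑(AR.theta a))
    (ρ : E →ₗ[k] E) (hmem : ∀ u : E, ρ u ∈ Rs) (hid : ∀ a ∈ Rs, ρ a = a) :
    ∃ D : ExtDatum k S ↥Rs ↥(LinearMap.ker ρ),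
      -- the extending datum is the one of Eq. (3.3):
      (∀ (a : ↥Rs) (x : ↥(LinearMap.ker ρ)),
          ((D.dR a x : E) = AE.mul ↑a ↑x - ρ (AE.mul ↑a ↑x)) ∧
          ((D.dL x a : E) = AE.mul ↑x ↑a - ρ (AE.mul ↑x ↑a)) ∧
          ((D.hL a x : E) = ρ (AE.mul ↑a ↑x)) ∧
          ((D.hR x a : E) = ρ (AE.mul ↑x ↑a))) ∧
      (∀ x y : ↥(LinearMap.ker ρ),
          ((D.f x y : E) = ρ (AE.mul ↑x ↑y)) ∧
          ((D.mulV x y : E) = AE.mul ↑x ↑y - ρ (AE.mul ↑x ↑y))) ∧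
      (∀ (ω : S) (x : ↥(LinearMap.ker ρ)),
          ((D.Q ω x : E) = ρ (AE.P ω ↑x)) ∧
          ((D.PV ω x : E) = AE.P ω ↑x - ρ (AE.P ω ↑x))) ∧
      (∀ x : ↥(LinearMap.ker ρ),
          ((D.eta x : E) = ρ (AE.theta ↑x)) ∧
          ((D.thetaV x : E) = AE.theta ↑x - ρ (AE.theta ↑x))) ∧
      -- it is a Rota-Baxter family Hom extending structure:
      IsExtendingStructure lam AR D ∧
      -- and φ(a,x) = a + x is an isomorphism R ♮ V → E
      Function.Bijective
        (fun p : ↥Rs × ↥(LinearMap.ker ρ) => (↑p.1 + ↑p.2 : E)) ∧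
      (∀ p q : ↥Rs × ↥(LinearMap.ker ρ),
        ((natMul AR D p q).1 : E) + ((natMul AR D p q).2 : E)
          = AE.mul (↑p.1 + ↑p.2) (↑q.1 + ↑q.2)) ∧
      (∀ (ω : S) (p : ↥Rs × ↥(LinearMap.ker ρ)),
        ((natP AR D ω p).1 : E) + ((natP AR D ω p).2 : E)
          = AE.P ω (↑p.1 + ↑p.2)) ∧
      (∀ p : ↥Rs × ↥(LinearMap.ker ρ),
        ((natTheta AR D p).1 : E) + ((natTheta AR D p).2 : E)
          = AE.theta (↑p.1 + ↑p.2)) ∧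
      -- φ stabilizes R:
      (∀ a : ↥Rs, ((a : E) + ((0 : ↥(LinearMap.ker ρ)) : E)) = (a : E)) ∧
      -- φ co-stabilizes V (π ∘ φ = π'):
      (∀ p : ↥Rs × ↥(LinearMap.ker ρ),
        ((↑p.1 + ↑p.2 : E) - ρ (↑p.1 + ↑p.2)) = (p.2 : E)) := by
  have hmul : ∀ p q : ↥Rs × ↥(LinearMap.ker ρ),
      ((natMul AR (retractionDatum AE ρ hmem hid) p q).1 : E)
        + ((natMul AR (retractionDatum AE ρ hmem hid) p q).2 : E)
        = AE.mul (↑p.1 + ↑p.2) (↑q.1 + ↑q.2) := fun p q => by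
    simp only [natMul, retractionDatum, kerProj, Submodule.coe_add, ← hRmul,
      LinearMap.compr₂_apply, LinearMap.compl₁₂_apply, LinearMap.codRestrict_apply,
      LinearMap.sub_apply, LinearMap.id_apply, Submodule.subtype_apply, map_add,
      LinearMap.add_apply]
    abel
  have hP : ∀ (ω : S) (p : ↥Rs × ↥(LinearMap.ker ρ)),
      ((natP AR (retractionDatum AE ρ hmem hid) ω p).1 : E)
        + ((natP AR (retractionDatum AE ρ hmem hid) ω p).2 : E)
        = AE.P ω (↑p.1 + ↑p.2) := fun ω p => by
    simp [natP, retractionDatum, kerProj, ← hRP, add_assoc]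
  have htheta : ∀ p : ↥Rs × ↥(LinearMap.ker ρ),
      ((natTheta AR (retractionDatum AE ρ hmem hid) p).1 : E)
        + ((natTheta AR (retractionDatum AE ρ hmem hid) p).2 : E)
        = AE.theta (↑p.1 + ↑p.2) := fun p => by
    simp [natTheta, retractionDatum, kerProj, ← hRtheta, add_assoc]
  have hbij := bijective_add_ker (Rs := Rs) hmem hid
  refine ⟨retractionDatum AE ρ hmem hid, fun _ _ => ⟨rfl, rfl, rfl, rfl⟩,
    fun _ _ => ⟨rfl, rfl⟩, fun _ _ => ⟨rfl, rfl⟩, fun _ => ⟨rfl, rfl⟩,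
    hAE.of_injective (Rs.subtype.coprod (LinearMap.ker ρ).subtype) ?_ hmul hP htheta,
    hbij, hmul, hP, htheta, fun a => add_zero _, fun p => ?_⟩
  · simpa [Function.Injective] using hbij.1
  · rw [map_add, hid _ p.1.2, LinearMap.mem_ker.1 p.2.2, add_zero, add_sub_cancel_left]
end

section
/- Let R be a Rota-Baxter family Hom-associative algebra of weight λ, E a k-vector space containing R as a subspace, ρ : E → R a linear retraction, and V := ker ρ. Let Exts(E,R) denote the set of all Rota-Baxter family Hom-associative algebra structures (·_E, (P_{ω,E})_{ω∈S}, θ_E) on E containing R as a subalgebra, and let O(R,V) denote the set of all Rota-Baxter family Hom extending structures of R through V. Then the map Υ₁ : Exts(E,R) → O(R,V), which sends an extension E to the extending datum defined by a▷x := a ·_E x − ρ(a ·_E x), x◁a := x ·_E a − ρ(x ·_E a), a↼x := ρ(a ·_E x), x⇀a := ρ(x ·_E a), f(x,y) := ρ(x ·_E y), x ·_V y := x ·_E y − ρ(x ·_E y), Q_ω(x) := ρ(P_{ω,E}(x)), P_{ω,V}(x) := P_{ω,E}(x) − ρ(P_{ω,E}(x)), η(x) := ρ(θ_E(x)), θ_V(x)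 := θ_E(x) − ρ(θ_E(x)), is a bijection; its inverse Υ₂ sends Ω(R,V) ∈ O(R,V) to the extension given by (a+x) ·_E (b+y) := a·b + a↼y + x⇀b + f(x,y) + a▷y + x◁b + x ·_V y, P_{ω,E}(a+x) := P_ω(a) + Q_ω(x) + P_{ω,V}(x), θ_E(a+x) := θ(a) + η(x) + θ_V(x), for a, b ∈ R, x, y ∈ V. -/
namespace IsRBFOps

variable {k S M N : Type*} [Field k] [Semigroup S] [AddCommGroup M] [Module k M]
  [AddCommGroup N] [Module k N]

/-- The axioms of a Rota-Baxter family Hom-associative algebra are reflected by an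
injective linear map that intertwines the operations. -/
theorem of_injective_s7 {lam : k} {mulM : M → M → M} {PM : S → M → M} {thM : M → M}
    {mulN : N → N → N} {PN : S → N → N} {thN : N → N} (φ : M →ₗ[k] N)
    (hφ : Function.Injective φ) (hmul : ∀ x y, φ (mulM x y) = mulN (φ x) (φ y))
    (hP : ∀ ω x, φ (PM ω x) = PN ω (φ x)) (hth : ∀ x, φ (thM x) = thN (φ x))
    (h : IsRBFOps lam mulN PN thN) : IsRBFOps lam mulM PM thM := by
  obtain ⟨hassoc, hRB, hcomm⟩ := h
  refine ⟨fun x y z => hφ ?_, fun α β x y => hφ ?_, fun ω x => hφ ?_⟩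
  · simp only [hmul, hth, hassoc]
  · simp only [hmul, hP, hRB, map_add, map_smul]
  · simp only [hP, hth, hcomm]

end IsRBFOps

section Transport

variable {k S R V E : Type*} [Field k] [Semigroup S] [AddCommGroup R] [Module k R]
  [AddCommGroup V] [Module k V] [AddCommGroup E] [Module k E]

/-- `B` extends `A` along the linear map `i`. -/
structure RBFData.Extends (B : RBFData k S E) (A : RBFData k S R) (i : R →ₗ[k] E) : Prop where
  mul (a b : R) : B.mul (i a) (i b) = i (A.mul a b)
  P (ω : S) (a : R) : B.P ω (i a) = i (A.P ω a)
  theta (a : R) : B.theta (i a) = i (A.theta a)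

/-- The extending datum read off from operations on `E` through a splitting `E ≃ R × V`. -/
def RBFData.toExtDatum (e : E ≃ₗ[k] R × V) (B : RBFData k S E) : ExtDatum k S R V :=
  let i : R →ₗ[k] E := e.symm ∘ₗ LinearMap.inl k R V
  let j : V →ₗ[k] E := e.symm ∘ₗ LinearMap.inr k R V
  let p : E →ₗ[k] R := LinearMap.fst k R V ∘ₗ e
  let q : E →ₗ[k] V := LinearMap.snd k R V ∘ₗ e
  { dR := (B.mul.compl₁₂ i j).compr₂ q
    dL := (B.mul.compl₁₂ j i).compr₂ q
    hR := (B.mul.compl₁₂ j i).compr₂ p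
    hL := (B.mul.compl₁₂ i j).compr₂ p
    f := (B.mul.compl₁₂ j j).compr₂ p
    mulV := (B.mul.compl₁₂ j j).compr₂ q
    Q := fun ω => p ∘ₗ B.P ω ∘ₗ j
    PV := fun ω => q ∘ₗ B.P ω ∘ₗ j
    eta := p ∘ₗ B.theta ∘ₗ j
    thetaV := q ∘ₗ B.theta ∘ₗ j }

/-- The operations of the unified product `R ♮ V`, carried to `E` through a splitting
`E ≃ R × V`. -/
def ExtDatum.toRBFData (e : E ≃ₗ[k] R × V) (A : RBFData k S R) (D : ExtDatum k S R V) :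
    RBFData k S E where
  mul := LinearMap.mk₂ k (fun u v => e.symm (natMul A D (e u) (e v)))
    (fun u u' v => by rw [← map_add]; congr 1; ext <;> simp [natMul] <;> abel)
    (fun c u v => by rw [← map_smul]; congr 1; ext <;> simp [natMul])
    (fun u v v' => by rw [← map_add]; congr 1; ext <;> simp [natMul] <;> abel)
    (fun c u v => by rw [← map_smul]; congr 1; ext <;> simp [natMul])
  P ω := e.symm ∘ₗ ((A.P ω).coprod (D.Q ω)).prod (D.PV ω ∘ₗ LinearMap.snd k R V) ∘ₗ e
  theta := e.symm ∘ₗ (A.theta.coprod D.eta).prod (D.thetaV ∘ₗ LinearMap.snd k R V) ∘ₗ e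

variable {e : E ≃ₗ[k] R × V} {A : RBFData k S R} {B : RBFData k S E} {D : ExtDatum k S R V}

theorem symm_mk_eq_add (a : R) (x : V) :
    e.symm (a, x) = e.symm (a, 0) + e.symm (0, x) := by
  rw [← map_add, Prod.mk_add_mk, add_zero, zero_add]

namespace ExtDatum

@[simp]
theorem toRBFData_mul (u v : E) :
    (D.toRBFData e A).mul u v = e.symm (natMul A D (e u) (e v)) := rfl

@[simp]
theorem toRBFData_P (ω : S) (u : E) :
    (D.toRBFData e A).P ω u = e.symm (natP A D ω (e u)) := rfl

@[simp]
theorem toRBFData_theta (u : E) :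
    (D.toRBFData e A).theta u = e.symm (natTheta A D (e u)) := rfl

theorem isRBF_toRBFData {lam : k} (h : IsExtendingStructure lam A D) :
    (D.toRBFData e A).IsRBF lam :=
  IsRBFOps.of_injective_s7 e.toLinearMap e.injective (by simp) (by simp) (by simp) h

theorem extends_toRBFData :
    (D.toRBFData e A).Extends A (e.symm ∘ₗ LinearMap.inl k R V) where
  mul a b := by simp [natMul]
  P ω a := by simp [natP]
  theta a := by simp [natTheta]

theorem toExtDatum_toRBFData : (D.toRBFData e A).toExtDatum e = D := by
  cases D
  simp only [RBFData.toExtDatum, ExtDatum.mk.injEq]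
  refine ⟨?_, ?_, ?_, ?_, ?_, ?_, ?_, ?_, ?_, ?_⟩ <;>
    ext <;> simp [natMul, natP, natTheta]

end ExtDatum

namespace RBFData.Extends

theorem apply_mul (h : B.Extends A (e.symm ∘ₗ LinearMap.inl k R V)) (u v : E) :
    e (B.mul u v) = natMul A (B.toExtDatum e) (e u) (e v) := by
  obtain ⟨⟨a, x⟩, rfl⟩ := e.symm.surjective u
  obtain ⟨⟨b, y⟩, rfl⟩ := e.symm.surjective v
  have hab : B.mul (e.symm (a, 0)) (e.symm (b, 0)) = e.symm (A.mul a b, 0) := h.mul a b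
  rw [symm_mk_eq_add a x, symm_mk_eq_add b y]
  ext <;> simp [natMul, toExtDatum, hab] <;> abel

theorem apply_P (h : B.Extends A (e.symm ∘ₗ LinearMap.inl k R V)) (ω : S) (u : E) :
    e (B.P ω u) = natP A (B.toExtDatum e) ω (e u) := by
  obtain ⟨⟨a, x⟩, rfl⟩ := e.symm.surjective u
  have ha : B.P ω (e.symm (a, 0)) = e.symm (A.P ω a, 0) := h.P ω a
  rw [symm_mk_eq_add a x]
  ext <;> simp [natP, toExtDatum, ha]

theorem apply_theta (h : B.Extends A (e.symm ∘ₗ LinearMap.inl k R V)) (u : E) :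
    e (B.theta u) = natTheta A (B.toExtDatum e) (e u) := by
  obtain ⟨⟨a, x⟩, rfl⟩ := e.symm.surjective u
  have ha : B.theta (e.symm (a, 0)) = e.symm (A.theta a, 0) := h.theta a
  rw [symm_mk_eq_add a x]
  ext <;> simp [natTheta, toExtDatum, ha]

theorem isExtendingStructure {lam : k} (h : B.Extends A (e.symm ∘ₗ LinearMap.inl k R V))
    (hB : B.IsRBF lam) : IsExtendingStructure lam A (B.toExtDatum e) :=
  IsRBFOps.of_injective_s7 e.symm.toLinearMap e.symm.injective
    (fun p q => by simpa using congrArg e.symm (h.apply_mul (e.symm p) (e.symm q)).symm)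
    (fun ω p => by simpa using congrArg e.symm (h.apply_P ω (e.symm p)).symm)
    (fun p => by simpa using congrArg e.symm (h.apply_theta (e.symm p)).symm) hB

theorem toRBFData_toExtDatum (h : B.Extends A (e.symm ∘ₗ LinearMap.inl k R V)) :
    (B.toExtDatum e).toRBFData e A = B := by
  have hmul : ((B.toExtDatum e).toRBFData e A).mul = B.mul := by
    ext u v; simp [← h.apply_mul]
  have hP : ((B.toExtDatum e).toRBFData e A).P = B.P := by
    funext ω; ext u; simp [← h.apply_P]
  have hth : ((B.toExtDatum e).toRBFData e A).theta = B.theta := by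
    ext u; simp [← h.apply_theta]
  cases B
  simp_all [ExtDatum.toRBFData]

end RBFData.Extends

end Transport

/-- The splitting of `E` into a subspace and the kernel of a retraction onto it. -/
def retractionEquiv {k E : Type*} [Field k] [AddCommGroup E] [Module k E]
    (Rs : Submodule k E) (ρ : E →ₗ[k] E) (hmem : ∀ u : E, ρ u ∈ Rs)
    (hid : ∀ a ∈ Rs, ρ a = a) : E ≃ₗ[k] Rs × LinearMap.ker ρ :=
  LinearEquiv.ofLinearMap
    ((ρ.codRestrict Rs hmem).prod
      ((LinearMap.id - ρ).codRestrict (LinearMap.ker ρ)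
        (fun u => by simp [hid _ (hmem u)])))
    (Rs.subtype.coprod (LinearMap.ker ρ).subtype)
    (by ext x <;> simp [hid])
    (by ext x; simp)

/-- The map `Υ₁ : Exts(E,R) → O(R,V)` sending an extension of `R` on `E` to the
extending datum of Eq. (3.3), is a bijection; its inverse `Υ₂` sends an extending
structure `Ω(R,V)` to the extension given by Eq. (3.8). Here `R` is realised as a
subspace `Rs` of `E` carrying the fixed structure `AR`, `ρ` is a linear retraction
onto `Rs` and `V := ker ρ`. -/
theorem stmt7 {k S E : Type*} [Field k] [Semigroup S] [AddCommGroup E] [Module k E]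
    (lam : k) (Rs : Submodule k E) (AR : RBFData k S ↥Rs) (hAR : AR.IsRBF lam)
    (ρ : E →ₗ[k] E) (hmem : ∀ u : E, ρ u ∈ Rs) (hid : ∀ a ∈ Rs, ρ a = a) :
    ∃ (F : {AE : RBFData k S E // AE.IsRBF lam ∧
              (∀ a b : ↥Rs, AE.mul ↑a ↑b = ↑(AR.mul a b)) ∧
              (∀ (ω : S) (a : ↥Rs), AE.P ω ↑a = ↑(AR.P ω a)) ∧
              (∀ a : ↥Rs, AE.theta ↑a = ↑(AR.theta a))}
            → {D : ExtDatum k S ↥Rs ↥(LinearMap.ker ρ) // IsExtendingStructure lam AR D})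
      (G : {D : ExtDatum k S ↥Rs ↥(LinearMap.ker ρ) // IsExtendingStructure lam AR D}
            → {AE : RBFData k S E // AE.IsRBF lam ∧
                (∀ a b : ↥Rs, AE.mul ↑a ↑b = ↑(AR.mul a b)) ∧
                (∀ (ω : S) (a : ↥Rs), AE.P ω ↑a = ↑(AR.P ω a)) ∧
                (∀ a : ↥Rs, AE.theta ↑a = ↑(AR.theta a))}),
      -- F is Υ₁, given by Eq. (3.3):
      (∀ AE, ∀ (a : ↥Rs) (x y : ↥(LinearMap.ker ρ)) (ω : S),
          (((F AE).1.dR a x : E) = AE.1.mul ↑a ↑x - ρ (AE.1.mul ↑a ↑x)) ∧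
          (((F AE).1.dL x a : E) = AE.1.mul ↑x ↑a - ρ (AE.1.mul ↑x ↑a)) ∧
          (((F AE).1.hL a x : E) = ρ (AE.1.mul ↑a ↑x)) ∧
          (((F AE).1.hR x a : E) = ρ (AE.1.mul ↑x ↑a)) ∧
          (((F AE).1.f x y : E) = ρ (AE.1.mul ↑x ↑y)) ∧
          (((F AE).1.mulV x y : E) = AE.1.mul ↑x ↑y - ρ (AE.1.mul ↑x ↑y)) ∧
          (((F AE).1.Q ω x : E) = ρ (AE.1.P ω ↑x)) ∧
          (((F AE).1.PV ω x : E) = AE.1.P ω ↑x - ρ (AE.1.P ω ↑x)) ∧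
          (((F AE).1.eta x : E) = ρ (AE.1.theta ↑x)) ∧
          (((F AE).1.thetaV x : E) = AE.1.theta ↑x - ρ (AE.1.theta ↑x))) ∧
      -- G is Υ₂, given by Eq. (3.8):
      (∀ D, ∀ (a b : ↥Rs) (x y : ↥(LinearMap.ker ρ)) (ω : S),
          ((G D).1.mul (↑a + ↑x) (↑b + ↑y)
            = ↑(AR.mul a b) + ↑(D.1.hL a y) + ↑(D.1.hR x b) + ↑(D.1.f x y)
              + ↑(D.1.dR a y) + ↑(D.1.dL x b) + ↑(D.1.mulV x y)) ∧
          ((G D).1.P ω (↑a + ↑x) = ↑(AR.P ω a) + ↑(D.1.Q ω x) + ↑(D.1.PV ω x)) ∧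
          ((G D).1.theta (↑a + ↑x) = ↑(AR.theta a) + ↑(D.1.eta x) + ↑(D.1.thetaV x))) ∧
      -- F and G are mutually inverse bijections:
      Function.LeftInverse G F ∧ Function.RightInverse G F ∧ Function.Bijective F := by
  let e := retractionEquiv Rs ρ hmem hid
  have hsymm : ∀ p : Rs × LinearMap.ker ρ, e.symm p = p.1 + p.2 := fun _ => rfl
  have hi : ∀ a : Rs, (e.symm ∘ₗ LinearMap.inl k Rs (LinearMap.ker ρ)) a = (a : E) := by
    simp [hsymm]
  have hj : ∀ x : LinearMap.ker ρ,
      (e.symm ∘ₗ LinearMap.inr k Rs (LinearMap.ker ρ)) x = (x : E) := by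
    simp [hsymm]
  have hsplit : ∀ (a : Rs) (x : LinearMap.ker ρ), e (a + x) = (a, x) := fun a x => by
    rw [← hsymm (a, x), e.apply_symm_apply]
  have extends_iff : ∀ B : RBFData k S E,
      B.Extends AR (e.symm ∘ₗ LinearMap.inl k Rs (LinearMap.ker ρ)) ↔
        (∀ a b : Rs, B.mul a b = AR.mul a b) ∧ (∀ (ω : S) (a : Rs), B.P ω a = AR.P ω a) ∧
          ∀ a : Rs, B.theta a = AR.theta a := fun B =>
    ⟨fun h => ⟨fun a b => by simpa only [hi] using h.mul a b,
        fun ω a => by simpa only [hi] using h.P ω a, fun a => by simpa only [hi] using h.theta a⟩,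
      fun h => ⟨fun a b => by simpa only [hi] using h.1 a b,
        fun ω a => by simpa only [hi] using h.2.1 ω a,
        fun a => by simpa only [hi] using h.2.2 a⟩⟩
  let F : {B : RBFData k S E // B.IsRBF lam ∧ (∀ a b : Rs, B.mul a b = AR.mul a b) ∧
      (∀ (ω : S) (a : Rs), B.P ω a = AR.P ω a) ∧ ∀ a : Rs, B.theta a = AR.theta a} →
      {D : ExtDatum k S Rs (LinearMap.ker ρ) // IsExtendingStructure lam AR D} := fun B =>
    ⟨B.1.toExtDatum e, ((extends_iff B.1).2 B.2.2).isExtendingStructure B.2.1⟩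
  let G : {D : ExtDatum k S Rs (LinearMap.ker ρ) // IsExtendingStructure lam AR D} →
      {B : RBFData k S E // B.IsRBF lam ∧ (∀ a b : Rs, B.mul a b = AR.mul a b) ∧
      (∀ (ω : S) (a : Rs), B.P ω a = AR.P ω a) ∧ ∀ a : Rs, B.theta a = AR.theta a} := fun D =>
    ⟨D.1.toRBFData e AR, ExtDatum.isRBF_toRBFData D.2,
      (extends_iff _).1 ExtDatum.extends_toRBFData⟩
  have hGF : Function.LeftInverse G F := fun B =>
    Subtype.ext ((extends_iff B.1).2 B.2.2).toRBFData_toExtDatum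
  have hFG : Function.RightInverse G F := fun D => Subtype.ext ExtDatum.toExtDatum_toRBFData
  refine ⟨F, G, fun B a x y ω => ?_, fun D a b x y ω => ?_, hGF, hFG,
    hGF.injective, hFG.surjective⟩
  · rw [← hi a, ← hj x, ← hj y]
    exact ⟨rfl, rfl, rfl, rfl, rfl, rfl, rfl, rfl, rfl, rfl⟩
  · refine ⟨?_, ?_, ?_⟩
    · simp only [G, ExtDatum.toRBFData_mul, hsplit, hsymm, natMul, Submodule.coe_add,
        add_assoc]
    · simp only [G, ExtDatum.toRBFData_P, hsplit, hsymm, natP, Submodule.coe_add]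
    · simp only [G, ExtDatum.toRBFData_theta, hsplit, hsymm, natTheta, Submodule.coe_add]
end

section
/- Let R be a Rota-Baxter family Hom-associative algebra of weight λ, V a k-vector space, and let Ω(R,V) and Ω′(R,V) be two Rota-Baxter family Hom extending structures of R through V (the structure maps of Ω′ being denoted ▷′, ◁′, ⇀′, ↼′, f′, ·_V′, Q′_ω, P′_{ω,V}, η′, θ′_V), with unified products R♮V and R♮′V. Let M be the set of morphisms of Rota-Baxter family Hom-associative algebras φ : R♮V → R♮′V with φ(a,0) = (a,0) for all a ∈ R, and let N be the set of pairs of linear maps (g, h), g : V → R, h : V → V, satisfying for all a ∈ R, x, y ∈ V, ω ∈ S: (E1) h(a▷x) = a▷′h(x), h(x◁a) = h(x)◁′a, h(P_{ω,V}(x)) = P′_{ω,V}(h(x)), h(θ_V(x)) = θ′_V(h(x)); (E2) a↼x + g(a▷x) = a·g(x) + a↼′h(x); (E3) x⇀a + g(x◁a) = g(x)·a + h(x)⇀′a; (E4) f(x,y) + g(x ·_V y) = g(x)·g(y) + g(x)↼′h(y) + h(x)⇀′g(y) + f′(h(x), h(y)); (E5) h(x ·_V y) = g(x)▷′h(y)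 + h(x)◁′g(y) + h(x) ·_V′ h(y); (E6) Q_ω(x) + g(P_{ω,V}(x)) = P_ω(g(x)) + Q′_ω(h(x)); (E7) η(x) + g(θ_V(x)) = θ(g(x)) + η′(h(x)). Then: (1) the map N → M sending (g,h) to φ defined by φ(a,x) := (a + g(x), h(x)) is a bijection; (2) under this bijection, φ is bijective if and only if h is bijective, and φ satisfies π′∘φ = π′ (where π′(a,x) = x) if and only if h = Id_V. -/
/-- The conditions (E1)–(E7) on a pair of linear maps `(g, h)` relating two
extending structures `D` and `D'` of `R` through `V`. -/
def GHConds {k S R V : Type*} [Field k] [Semigroup S]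
    [AddCommGroup R] [Module k R] [AddCommGroup V] [Module k V]
    (A : RBFData k S R) (D D' : ExtDatum k S R V)
    (g : V →ₗ[k] R) (h : V →ₗ[k] V) : Prop :=
  -- (E1) h is an R-bimodule morphism
  (∀ (a : R) (x : V), h (D.dR a x) = D'.dR a (h x)) ∧
  (∀ (x : V) (a : R), h (D.dL x a) = D'.dL (h x) a) ∧
  (∀ (ω : S) (x : V), h (D.PV ω x) = D'.PV ω (h x)) ∧
  (∀ x : V, h (D.thetaV x) = D'.thetaV (h x)) ∧
  -- (E2)
  (∀ (a : R) (x : V), D.hL a x + g (D.dR a x) = A.mul a (g x) + D'.hL a (h x)) ∧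
  -- (E3)
  (∀ (x : V) (a : R), D.hR x a + g (D.dL x a) = A.mul (g x) a + D'.hR (h x) a) ∧
  -- (E4)
  (∀ x y : V, D.f x y + g (D.mulV x y)
      = A.mul (g x) (g y) + D'.hL (g x) (h y) + D'.hR (h x) (g y) + D'.f (h x) (h y)) ∧
  -- (E5)
  (∀ x y : V, h (D.mulV x y) = D'.dR (g x) (h y) + D'.dL (h x) (g y) + D'.mulV (h x) (h y)) ∧
  -- (E6)
  (∀ (ω : S) (x : V), D.Q ω x + g (D.PV ω x) = A.P ω (g x) + D'.Q ω (h x)) ∧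
  -- (E7)
  (∀ x : V, D.eta x + g (D.thetaV x) = A.theta (g x) + D'.eta (h x))

section Stabilizing

variable {k S R V : Type*} [Field k] [Semigroup S]
  [AddCommGroup R] [Module k R] [AddCommGroup V] [Module k V]

/-- The linear endomorphism `(a, x) ↦ (a + g x, h x)` of `R × V`. -/
def stabilizingMap (g : V →ₗ[k] R) (h : V →ₗ[k] V) : (R × V) →ₗ[k] (R × V) :=
  (LinearMap.fst k R V + g ∘ₗ LinearMap.snd k R V).prod (h ∘ₗ LinearMap.snd k R V)

@[simp]
theorem stabilizingMap_apply (g : V →ₗ[k] R) (h : V →ₗ[k] V) (p : R × V) :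
    stabilizingMap g h p = (p.1 + g p.2, h p.2) := rfl

/-- A linear map fixing `R × 0` pointwise is determined by its restriction to `0 × V`. -/
theorem eq_stabilizingMap (φ : (R × V) →ₗ[k] (R × V)) (hφ : ∀ a : R, φ (a, 0) = (a, 0)) :
    φ = stabilizingMap (LinearMap.fst k R V ∘ₗ φ ∘ₗ LinearMap.inr k R V)
      (LinearMap.snd k R V ∘ₗ φ ∘ₗ LinearMap.inr k R V) := by
  ext <;> simp [hφ]

theorem stabilizingMap_injective {g g' : V →ₗ[k] R} {h h' : V →ₗ[k] V}
    (e : stabilizingMap g h = stabilizingMap g' h') : g = g' ∧ h = h' := by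
  have key (x : V) := LinearMap.congr_fun e (0, x)
  simp only [stabilizingMap_apply, zero_add, Prod.mk.injEq] at key
  exact ⟨LinearMap.ext fun x => (key x).1, LinearMap.ext fun x => (key x).2⟩

theorem stabilizingMap_bijective_iff (g : V →ₗ[k] R) (h : V →ₗ[k] V) :
    Function.Bijective (stabilizingMap g h) ↔ Function.Bijective h := by
  refine ⟨fun ⟨hi, hs⟩ => ⟨fun x y e => ?_, fun y => ?_⟩,
    fun ⟨hi, hs⟩ => ⟨fun p q e => ?_, fun q => ?_⟩⟩
  · have := @hi (-g x, x) (-g y, y) (by simp [e])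
    exact congrArg Prod.snd this
  · obtain ⟨p, hp⟩ := hs (0, y)
    exact ⟨p.2, congrArg Prod.snd hp⟩
  · simp only [stabilizingMap_apply, Prod.mk.injEq] at e
    have e₂ := hi e.2
    exact Prod.ext (by simpa [e₂] using e.1) e₂
  · obtain ⟨x, hx⟩ := hs q.2
    exact ⟨(q.1 - g x, x), by simp [hx]⟩

theorem GHConds.map_natMul {A : RBFData k S R} {D D' : ExtDatum k S R V}
    {g : V →ₗ[k] R} {h : V →ₗ[k] V} (H : GHConds A D D' g h) (p q : R × V) :
    stabilizingMap g h (natMul A D p q)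
      = natMul A D' (stabilizingMap g h p) (stabilizingMap g h q) := by
  obtain ⟨hdR, hdL, -, -, hhL, hhR, hf, hmul, -, -⟩ := H
  obtain ⟨a, x⟩ := p
  obtain ⟨b, y⟩ := q
  simp only [natMul, stabilizingMap_apply, map_add, LinearMap.add_apply, hdR, hdL, hmul,
    Prod.mk.injEq]
  constructor
  · linear_combination (norm := module) hhL a y + hhR x b + hf x y
  · abel

theorem GHConds.map_natP {A : RBFData k S R} {D D' : ExtDatum k S R V}
    {g : V →ₗ[k] R} {h : V →ₗ[k] V} (H : GHConds A D D' g h) (ω : S) (p : R × V) :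
    stabilizingMap g h (natP A D ω p) = natP A D' ω (stabilizingMap g h p) := by
  obtain ⟨-, -, hPV, -, -, -, -, -, hQ, -⟩ := H
  simp [natP, hPV, add_assoc, hQ]

theorem GHConds.map_natTheta {A : RBFData k S R} {D D' : ExtDatum k S R V}
    {g : V →ₗ[k] R} {h : V →ₗ[k] V} (H : GHConds A D D' g h) (p : R × V) :
    stabilizingMap g h (natTheta A D p) = natTheta A D' (stabilizingMap g h p) := by
  obtain ⟨-, -, -, hθ, -, -, -, -, -, hη⟩ := H
  simp [natTheta, hθ, add_assoc, hη]

theorem GHConds.of_stabilizingMap {A : RBFData k S R} {D D' : ExtDatum k S R V}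
    {g : V →ₗ[k] R} {h : V →ₗ[k] V}
    (hmul : ∀ p q : R × V, stabilizingMap g h (natMul A D p q)
      = natMul A D' (stabilizingMap g h p) (stabilizingMap g h q))
    (hP : ∀ (ω : S) (p : R × V),
      stabilizingMap g h (natP A D ω p) = natP A D' ω (stabilizingMap g h p))
    (hθ : ∀ p : R × V,
      stabilizingMap g h (natTheta A D p) = natTheta A D' (stabilizingMap g h p)) :
    GHConds A D D' g h := by
  have hRV (a : R) (x : V) := hmul (a, 0) (0, x)
  have hVR (x : V) (a : R) := hmul (0, x) (a, 0)
  have hVV (x y : V) := hmul (0, x) (0, y)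
  have hPV (ω : S) (x : V) := hP ω (0, x)
  have hθV (x : V) := hθ (0, x)
  simp only [natMul, natP, natTheta, stabilizingMap_apply, map_zero, LinearMap.zero_apply,
    zero_add, add_zero, Prod.mk.injEq] at hRV hVR hVV hPV hθV
  exact ⟨fun a x => (hRV a x).2, fun x a => (hVR x a).2, fun ω x => (hPV ω x).2,
    fun x => (hθV x).2, fun a x => (hRV a x).1, fun x a => (hVR x a).1,
    fun x y => (hVV x y).1, fun x y => (hVV x y).2, fun ω x => (hPV ω x).1,
    fun x => (hθV x).1⟩

end Stabilizing

/-- Lemma 3.12: for two Rota-Baxter family Hom extending structures `D, D'` of `R`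
through `V`, the set `N` of pairs `(g,h)` satisfying (E1)–(E7) is in bijection
with the set `M` of morphisms of Rota-Baxter family Hom-associative algebras
`φ : R ♮ V → R ♮' V` stabilizing `R`, via `(g,h) ↦ φ` with `φ(a,x) = (a + g(x), h(x))`;
under this bijection `φ` is bijective iff `h` is bijective, and `φ` co-stabilizes
`V` iff `h = Id_V`. -/
theorem stmt8 {k S R V : Type*} [Field k] [Semigroup S]
    [AddCommGroup R] [Module k R] [AddCommGroup V] [Module k V]
    (lam : k) (A : RBFData k S R) (hA : A.IsRBF lam)
    (D D' : ExtDatum k S R V)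
    (hD : IsExtendingStructure lam A D) (hD' : IsExtendingStructure lam A D') :
    ∃ T : {gh : (V →ₗ[k] R) × (V →ₗ[k] V) // GHConds A D D' gh.1 gh.2}
          → {φ : (R × V) →ₗ[k] (R × V) //
              (∀ p q : R × V, φ (natMul A D p q) = natMul A D' (φ p) (φ q)) ∧
              (∀ (ω : S) (p : R × V), φ (natP A D ω p) = natP A D' ω (φ p)) ∧
              (∀ p : R × V, φ (natTheta A D p) = natTheta A D' (φ p)) ∧
              (∀ a : R, φ (a, 0) = (a, 0))},
      (∀ gh (a : R) (x : V), (T gh).1 (a, x) = (a + gh.1.1 x, gh.1.2 x)) ∧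
      Function.Bijective T ∧
      (∀ gh, Function.Bijective ((T gh).1 : R × V → R × V)
        ↔ Function.Bijective (gh.1.2 : V → V)) ∧
      (∀ gh, (∀ p : R × V, ((T gh).1 p).2 = p.2) ↔ ∀ x : V, gh.1.2 x = x) := by
  refine ⟨fun gh => ⟨stabilizingMap gh.1.1 gh.1.2, gh.2.map_natMul, gh.2.map_natP,
    gh.2.map_natTheta, fun a => by simp⟩, fun gh a x => rfl, ⟨fun gh gh' e => ?_, ?_⟩,
    fun gh => stabilizingMap_bijective_iff _ _, fun gh => ⟨fun H x => H (0, x), fun H p => H p.2⟩⟩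
  · obtain ⟨hg, hh⟩ := stabilizingMap_injective (congrArg Subtype.val e)
    exact Subtype.ext (Prod.ext hg hh)
  · rintro ⟨φ, hmul, hP, hθ, hR⟩
    have e := eq_stabilizingMap φ hR
    rw [e] at hmul hP hθ
    exact ⟨⟨(_, _), GHConds.of_stabilizingMap hmul hP hθ⟩, Subtype.ext e.symm⟩
end

section
/- Let R be a Rota-Baxter family Hom-associative algebra of weight λ and V a one-dimensional k-vector space with basis {x}. Then the map Φ sending a flag datum Ω(R) = (l, r, t_r, t_l, a₁, k̄₁, (b_ω)_{ω∈S}, (k̄_ω)_{ω∈S}, a₂, k̄₂) of R to the extending datum Ω(R,V) defined by a▷x := l(a)x, x◁a := r(a)x, a↼x := t_l(a), x⇀a := t_r(a), f(x,x) := a₁, x ·_V x := k̄₁x, Q_ω(x) := b_ω, P_{ω,V}(x) := k̄_ω x, η(x) := a₂, θ_V(x) := k̄₂x (for a ∈ R, ω ∈ S) is a bijection from the set F(R) of all flag datums of R onto the set O(R,V) of all Rota-Baxter family Hom extending structures of R through V. -/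
/-- The data of a flag datum `(l, r, t_r, t_l, a₁, k̄₁, (b_ω), (k̄_ω), a₂, k̄₂)` of a
Rota-Baxter family Hom-associative algebra `R`. -/
structure FlagDatum (k S R : Type*) [Field k] [Semigroup S]
    [AddCommGroup R] [Module k R] where
  l : R →ₗ[k] k
  r : R →ₗ[k] k
  tr : R →ₗ[k] R
  tl : R →ₗ[k] R
  a1 : R
  k1 : k
  b : S → R
  kk : S → k
  a2 : R
  k2 : k

/-- The conditions (F1)–(F21) making a tuple a flag datum of `R`. -/
def FlagDatum.IsFlag {k S R : Type*} [Field k] [Semigroup S]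
    [AddCommGroup R] [Module k R]
    (Fd : FlagDatum k S R) (lam : k) (A : RBFData k S R) : Prop :=
  (∀ a b : R, Fd.l (A.mul a b) * Fd.k2 = Fd.l (A.theta a) * Fd.l b) ∧ -- (F1)
  (∀ a b : R, Fd.r a * Fd.r (A.theta b) = Fd.r (A.mul a b) * Fd.k2) ∧ -- (F2)
  (∀ a b : R, Fd.l a * Fd.r (A.theta b) = Fd.l (A.theta a) * Fd.r b) ∧ -- (F3)
  (∀ (α β : S) (a : R), Fd.l (A.P α a) * Fd.kk β
      = Fd.kk (α * β) * (Fd.l (A.P α a) + Fd.l a * Fd.kk β + lam * Fd.l a)) ∧ -- (F4)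
  (∀ (α β : S) (a : R), Fd.kk α * Fd.r (A.P β a)
      = Fd.kk (α * β) * (Fd.kk α * Fd.r a + Fd.r (A.P β a) + lam * Fd.r a)) ∧ -- (F5)
  (∀ a b : R, A.mul (A.mul a b) Fd.a2 + Fd.k2 • Fd.tl (A.mul a b)
      = A.mul (A.theta a) (Fd.tl b) + Fd.l b • Fd.tl (A.theta a)) ∧ -- (F6)
  (∀ a b : R, A.mul (Fd.tr a) (A.theta b) + Fd.r a • Fd.tr (A.theta b)
      = A.mul Fd.a2 (A.mul a b) + Fd.k2 • Fd.tr (A.mul a b)) ∧ -- (F7)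
  (∀ a b : R, A.mul (Fd.tl a) (A.theta b) + Fd.l a • Fd.tr (A.theta b)
      = A.mul (A.theta a) (Fd.tr b) + Fd.r b • Fd.tl (A.theta a)) ∧ -- (F8)
  (∀ a : R, A.mul Fd.a1 (A.theta a) + Fd.k1 • Fd.tr (A.theta a)
      = A.mul Fd.a2 (Fd.tr a) + Fd.r a • Fd.tl Fd.a2 + Fd.k2 • Fd.tr (Fd.tr a)
        + (Fd.k2 * Fd.r a) • Fd.a1) ∧ -- (F9)
  (∀ a : R, Fd.k1 * Fd.r (A.theta a)
      = Fd.l Fd.a2 * Fd.r a + Fd.k2 * Fd.r (Fd.tr a) + Fd.k1 * Fd.k2 * Fd.r a) ∧ -- (F10)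
  (∀ a : R, A.mul (Fd.tl a) Fd.a2 + Fd.k2 • Fd.tl (Fd.tl a) + Fd.l a • Fd.tr Fd.a2
        + (Fd.l a * Fd.k2) • Fd.a1
      = A.mul (A.theta a) Fd.a1 + Fd.k1 • Fd.tl (A.theta a)) ∧ -- (F11)
  (∀ a : R, Fd.l (Fd.tl a) * Fd.k2 + Fd.l a * Fd.r Fd.a2 + Fd.l a * Fd.k1 * Fd.k2
      = Fd.l (A.theta a) * Fd.k1) ∧ -- (F12)
  (∀ a : R, A.mul (Fd.tr a) Fd.a2 + Fd.k2 • Fd.tl (Fd.tr a) + Fd.r a • Fd.tr Fd.a2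
        + (Fd.r a * Fd.k2) • Fd.a1
      = A.mul Fd.a2 (Fd.tl a) + Fd.l a • Fd.tl Fd.a2 + Fd.k2 • Fd.tr (Fd.tl a)
        + (Fd.k2 * Fd.l a) • Fd.a1) ∧ -- (F13)
  (∀ a : R, Fd.l (Fd.tr a) * Fd.k2 + Fd.r a * Fd.r Fd.a2 + Fd.r a * Fd.k1 * Fd.k2
      = Fd.l Fd.a2 * Fd.l a + Fd.k2 * Fd.r (Fd.tl a) + Fd.k2 * Fd.k1 * Fd.l a) ∧ -- (F14)
  (A.mul Fd.a1 Fd.a2 + Fd.k2 • Fd.tl Fd.a1 + Fd.k1 • Fd.tr Fd.a2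
      = A.mul Fd.a2 Fd.a1 + Fd.k1 • Fd.tl Fd.a2 + Fd.k2 • Fd.tr Fd.a1) ∧ -- (F15)
  (Fd.l Fd.a1 * Fd.k2 + Fd.k1 * Fd.r Fd.a2
      = Fd.l Fd.a2 * Fd.k1 + Fd.k2 * Fd.r Fd.a1) ∧ -- (F16)
  (∀ (α β : S) (a : R), A.mul (A.P α a) (Fd.b β) + Fd.kk β • Fd.tl (A.P α a)
      = A.P (α * β) (Fd.tl (A.P α a) + A.mul a (Fd.b β) + Fd.kk β • Fd.tl a
          + lam • Fd.tl a)
        + (Fd.l (A.P α a) + Fd.l a * Fd.kk β + lam * Fd.l a) • Fd.b (α * β)) ∧ -- (F17)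
  (∀ (α β : S) (a : R), A.mul (Fd.b α) (A.P β a) + Fd.kk α • Fd.tr (A.P β a)
      = A.P (α * β) (A.mul (Fd.b α) a + Fd.kk α • Fd.tr a + Fd.tr (A.P β a)
          + lam • Fd.tr a)
        + (Fd.kk α * Fd.r a + Fd.r (A.P β a) + lam * Fd.r a) • Fd.b (α * β)) ∧ -- (F18)
  (∀ α β : S, A.mul (Fd.b α) (Fd.b β) + Fd.kk β • Fd.tl (Fd.b α)
        + Fd.kk α • Fd.tr (Fd.b β) + (Fd.kk α * Fd.kk β) • Fd.a1
      = A.P (α * β) (Fd.tl (Fd.b α) + Fd.kk α • Fd.a1 + Fd.tr (Fd.b β)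
          + Fd.kk β • Fd.a1 + lam • Fd.a1)
        + (Fd.l (Fd.b α) + Fd.kk α * Fd.k1 + Fd.r (Fd.b β) + Fd.k1 * Fd.kk β
            + lam * Fd.k1) • Fd.b (α * β)) ∧ -- (F19)
  (∀ α β : S, Fd.l (Fd.b α) * Fd.kk β + Fd.kk α * Fd.r (Fd.b β)
        + Fd.k1 * Fd.kk α * Fd.kk β
      = Fd.kk (α * β) * (Fd.l (Fd.b α) + Fd.k1 * Fd.kk α + Fd.r (Fd.b β)
          + Fd.k1 * Fd.kk β + lam * Fd.k1)) ∧ -- (F20)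
  (∀ α : S, A.theta (Fd.b α) + Fd.kk α • Fd.a2 = A.P α Fd.a2 + Fd.k2 • Fd.b α) -- (F21)

/-- The extending datum of `R` through `k` attached to a flag datum, inverse to evaluation at the
basis vector `1`. -/
def flagEquivExt (k S R : Type*) [Field k] [Semigroup S] [AddCommGroup R] [Module k R] :
    FlagDatum k S R ≃ ExtDatum k S R k where
  toFun Fd :=
    { dR := (LinearMap.toSpanSingleton k _ Fd.l).flip
      dL := LinearMap.toSpanSingleton k _ Fd.r
      hR := LinearMap.toSpanSingleton k _ Fd.tr
      hL := (LinearMap.toSpanSingleton k _ Fd.tl).flip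
      f := LinearMap.toSpanSingleton k _ (LinearMap.toSpanSingleton k _ Fd.a1)
      mulV := LinearMap.toSpanSingleton k _ (LinearMap.toSpanSingleton k _ Fd.k1)
      Q := fun ω => LinearMap.toSpanSingleton k _ (Fd.b ω)
      PV := fun ω => LinearMap.toSpanSingleton k _ (Fd.kk ω)
      eta := LinearMap.toSpanSingleton k _ Fd.a2
      thetaV := LinearMap.toSpanSingleton k _ Fd.k2 }
  invFun D :=
    { l := D.dR.flip 1
      r := D.dL 1
      tr := D.hR 1
      tl := D.hL.flip 1
      a1 := D.f 1 1
      k1 := D.mulV 1 1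
      b := fun ω => D.Q ω 1
      kk := fun ω => D.PV ω 1
      a2 := D.eta 1
      k2 := D.thetaV 1 }
  left_inv Fd := by
    cases Fd
    simp only [FlagDatum.mk.injEq]
    refine ⟨?_, ?_, ?_, ?_, ?_, ?_, ?_, ?_, ?_, ?_⟩ <;> (try ext) <;> simp
  right_inv D := by
    cases D
    simp only [ExtDatum.mk.injEq]
    refine ⟨?_, ?_, ?_, ?_, ?_, ?_, ?_, ?_, ?_, ?_⟩ <;> (try ext) <;> simp

section FlagExt

variable {k S R : Type*} [Field k] [Semigroup S] [AddCommGroup R] [Module k R]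

theorem natMul_flagEquivExt (A : RBFData k S R) (Fd : FlagDatum k S R) (p q : R × k) :
    natMul A (flagEquivExt k S R Fd) p q =
      (A.mul p.1 q.1 + q.2 • Fd.tl p.1 + p.2 • Fd.tr q.1 + (p.2 * q.2) • Fd.a1,
        Fd.l p.1 * q.2 + p.2 * Fd.r q.1 + Fd.k1 * p.2 * q.2) := by
  ext
  · simp [natMul, flagEquivExt, mul_smul]
  · simp [natMul, flagEquivExt]; ring

theorem natP_flagEquivExt (A : RBFData k S R) (Fd : FlagDatum k S R) (ω : S) (p : R × k) :
    natP A (flagEquivExt k S R Fd) ω p = (A.P ω p.1 + p.2 • Fd.b ω, Fd.kk ω * p.2) := by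
  simp [natP, flagEquivExt, mul_comm]

theorem natTheta_flagEquivExt (A : RBFData k S R) (Fd : FlagDatum k S R) (p : R × k) :
    natTheta A (flagEquivExt k S R Fd) p = (A.theta p.1 + p.2 • Fd.a2, Fd.k2 * p.2) := by
  simp [natTheta, flagEquivExt, mul_comm]

theorem FlagDatum.IsFlag.isExtendingStructure {lam : k} {A : RBFData k S R} (hA : A.IsRBF lam)
    {Fd : FlagDatum k S R} (h : Fd.IsFlag lam A) :
    IsExtendingStructure lam A (flagEquivExt k S R Fd) := by
  obtain ⟨hassoc, hrb, hcomm⟩ := hA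
  obtain ⟨F1, F2, F3, F4, F5, F6, F7, F8, F9, F10, F11, F12, F13, F14, F15, F16, F17, F18, F19,
    F20, F21⟩ := h
  refine ⟨?_, ?_, ?_⟩
  · rintro ⟨a, s⟩ ⟨b, t⟩ ⟨c, u⟩
    simp only [natMul_flagEquivExt, natTheta_flagEquivExt, Prod.mk.injEq, map_add, map_smul,
      LinearMap.add_apply, LinearMap.smul_apply, smul_eq_mul]
    constructor
    · linear_combination (norm := module) hassoc a b c - u • F6 a b - s • F7 b c - t • F8 a c
        - (s * t) • F9 c - (t * u) • F11 a - (s * u) • F13 b - (s * t * u) • F15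
    · linear_combination -u * F1 a b - s * F2 b c - t * F3 a c
        - (s * t) * F10 c - (t * u) * F12 a - (s * u) * F14 b - (s * t * u) * F16
  · rintro α β ⟨a, s⟩ ⟨b, t⟩
    simp only [natMul_flagEquivExt, natP_flagEquivExt, Prod.mk.injEq, map_add, map_smul,
      LinearMap.add_apply, LinearMap.smul_apply, smul_eq_mul, Prod.smul_mk, Prod.mk_add_mk]
    have hab := hrb α β a b
    have h17 := F17 α β a
    have h18 := F18 α β b
    have h19 := F19 α β
    simp only [map_add, map_smul] at hab h17 h18 h19
    constructor
    · linear_combination (norm := module) hab + t • h17 + s • h18 + (s * t) • h19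
    · linear_combination t * F4 α β a + s * F5 α β b + (s * t) * F20 α β
  · rintro ω ⟨a, s⟩
    have h := hcomm ω a
    simp only [natTheta_flagEquivExt, natP_flagEquivExt, Prod.mk.injEq, map_add, map_smul]
    constructor
    · linear_combination (norm := module) h - s • F21 ω
    · ring

theorem FlagDatum.isFlag_of_isExtendingStructure {lam : k} {A : RBFData k S R}
    {Fd : FlagDatum k S R} (h : IsExtendingStructure lam A (flagEquivExt k S R Fd)) :
    Fd.IsFlag lam A := by
  obtain ⟨hassoc, hrb, hcomm⟩ := h
  simp only [natMul_flagEquivExt, natTheta_flagEquivExt, natP_flagEquivExt, Prod.ext_iff,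
    Prod.smul_mk, Prod.mk_add_mk] at hassoc hrb hcomm
  have aab (a b : R) := hassoc (a, 0) (b, 0) (0, 1)
  have eab (a b : R) := hassoc (0, 1) (a, 0) (b, 0)
  have aeb (a b : R) := hassoc (a, 0) (0, 1) (b, 0)
  have eea (a : R) := hassoc (0, 1) (0, 1) (a, 0)
  have aee (a : R) := hassoc (a, 0) (0, 1) (0, 1)
  have eae (a : R) := hassoc (0, 1) (a, 0) (0, 1)
  have eee := hassoc (0, 1) (0, 1) (0, 1)
  have ae (α β : S) (a : R) := hrb α β (a, 0) (0, 1)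
  have ea (α β : S) (a : R) := hrb α β (0, 1) (a, 0)
  have ee (α β : S) := hrb α β (0, 1) (0, 1)
  have ce (α : S) := hcomm α (0, 1)
  clear hassoc hrb hcomm
  simp only [map_add, map_smul, map_zero,
    LinearMap.zero_apply, smul_eq_mul, mul_zero, zero_mul, mul_one, one_mul, add_zero, zero_add,
    zero_smul, smul_zero, one_smul] at aab eab aeb eea aee eae eee ae ea ee ce
  refine ⟨fun a b => ?_, fun a b => ?_, fun a b => ?_, fun α β a => ?_, fun α β a => ?_,
    fun a b => ?_, fun a b => ?_, fun a b => ?_, fun a => ?_, fun a => ?_, fun a => ?_,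
    fun a => ?_, fun a => ?_, fun a => ?_, ?_, ?_, fun α β a => ?_, fun α β a => ?_,
    fun α β => ?_, fun α β => ?_, fun α => ?_⟩ <;> (try simp only [map_add, map_smul])
  · linear_combination -(aab a b).2
  · linear_combination -(eab a b).2
  · linear_combination -(aeb a b).2
  · linear_combination (ae α β a).2
  · linear_combination (ea α β a).2
  · linear_combination (norm := module) -(aab a b).1
  · linear_combination (norm := module) -(eab a b).1
  · linear_combination (norm := module) -(aeb a b).1
  · linear_combination (norm := module) -(eea a).1
  · linear_combination -(eea a).2
  · linear_combination (norm := module) -(aee a).1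
  · linear_combination -(aee a).2
  · linear_combination (norm := module) -(eae a).1
  · linear_combination -(eae a).2
  · linear_combination (norm := module) -eee.1
  · linear_combination -eee.2
  · linear_combination (norm := module) (ae α β a).1
  · linear_combination (norm := module) (ea α β a).1
  · linear_combination (norm := module) (ee α β).1
  · linear_combination (ee α β).2
  · linear_combination (norm := module) -(ce α).1

end FlagExt

/-- Theorem 3.20: for `R` a Rota-Baxter family Hom-associative algebra and `V` a
one-dimensional vector space (realised as `k` itself with basis `{1}`), the map `Φ`
defined by Eq. (3.9) is a bijection between the set `F(R)` of flag datums of `R`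
and the set `O(R,V)` of Rota-Baxter family Hom extending structures of `R`
through `V`. -/
theorem stmt10 {k S R : Type*} [Field k] [Semigroup S]
    [AddCommGroup R] [Module k R]
    (lam : k) (A : RBFData k S R) (hA : A.IsRBF lam) :
    ∃ Φ : {Fd : FlagDatum k S R // Fd.IsFlag lam A}
          → {D : ExtDatum k S R k // IsExtendingStructure lam A D},
      (∀ (Fd : {Fd : FlagDatum k S R // Fd.IsFlag lam A}) (a : R) (ω : S),
          ((Φ Fd).1.dR a (1 : k) = Fd.1.l a) ∧
          ((Φ Fd).1.dL (1 : k) a = Fd.1.r a) ∧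
          ((Φ Fd).1.hL a (1 : k) = Fd.1.tl a) ∧
          ((Φ Fd).1.hR (1 : k) a = Fd.1.tr a) ∧
          ((Φ Fd).1.f (1 : k) (1 : k) = Fd.1.a1) ∧
          ((Φ Fd).1.mulV (1 : k) (1 : k) = Fd.1.k1) ∧
          ((Φ Fd).1.Q ω (1 : k) = Fd.1.b ω) ∧
          ((Φ Fd).1.PV ω (1 : k) = Fd.1.kk ω) ∧
          ((Φ Fd).1.eta (1 : k) = Fd.1.a2) ∧
          ((Φ Fd).1.thetaV (1 : k) = Fd.1.k2)) ∧
      Function.Bijective Φ := by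
  refine ⟨(flagEquivExt k S R).subtypeEquiv fun _ =>
    ⟨FlagDatum.IsFlag.isExtendingStructure hA, FlagDatum.isFlag_of_isExtendingStructure⟩,
    fun Fd a ω => ?_, Equiv.bijective _⟩
  simp [flagEquivExt]
end
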